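/- Let N ≥ 2 and let b_1,…,b_N be real parameters. On the open subset of ℝ^{2N} where every q_i ≠ 0, define J_- = Σ_{i=1}^N q_i², J_+ = Σ_{i=1}^N (p_i² + b_i/q_i²), J_3 = Σ_{i=1}^N q_i p_i, and for 2 ≤ m ≤ N define C^{(m)} = Σ_{1≤i<j≤m}[(q_i p_j − q_j p_i)² + b_i q_j²/q_i² + b_j q_i²/q_j²] + Σ_{i=1}^m b_i and C_{(m)} = Σ_{N−m+1≤i<j≤N}[(q_i p_j − q_j p_i)² + b_i q_j²/q_i² + b_j q_i²/q_j²] + Σ_{i=N−m+1}^N b_i. Then for every m with 2 ≤ m ≤ N and every l ∈ {−, +, 3}, the canonical Poisson brackets {C^{(m)}, J_l} and {C_{(m)}, J_l} vanish identically. -/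

import Mathlib

open scoped BigOperators
open Real

noncomputable section

/-- Phase space ℝ^{2N} with canonical coordinates (q, p). -/
abbrev Phase (N : ℕ) : Type := (Fin N → ℝ) × (Fin N → ℝ)

/-- The canonical Poisson bracket
`{f,g} = ∑ i, (∂f/∂q_i · ∂g/∂p_i − ∂g/∂q_i · ∂f/∂p_i)`. -/
noncomputable def pb {N : ℕ} (f g : Phase N → ℝ) (x : Phase N) : ℝ :=
  ∑ i : Fin N,
    ((fderiv ℝ f x) (Pi.single i 1, 0) * (fderiv ℝ g x) (0, Pi.single i 1)
      - (fderiv ℝ g x) (Pi.single i 1, 0) * (fderiv ℝ f x) (0, Pi.single i 1))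

/-- `J_- = Σ q_i²`. -/
noncomputable def Jm (N : ℕ) : Phase N → ℝ := fun x => ∑ i : Fin N, (x.1 i) ^ 2

/-- `J_+ = Σ (p_i² + b_i/q_i²)`. -/
noncomputable def Jp (N : ℕ) (b : Fin N → ℝ) : Phase N → ℝ :=
  fun x => ∑ i : Fin N, ((x.2 i) ^ 2 + b i / (x.1 i) ^ 2)

/-- `J_3 = Σ q_i p_i`. -/
noncomputable def J3 (N : ℕ) : Phase N → ℝ := fun x => ∑ i : Fin N, x.1 i * x.2 i

/-- The "left" integrals `C^{(m)}` (indices `1 ≤ i < j ≤ m` of the paper are the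
0-indexed `i < j < m` here). -/
noncomputable def Cleft (N : ℕ) (b : Fin N → ℝ) (m : ℕ) : Phase N → ℝ :=
  fun x =>
    (∑ i : Fin N, ∑ j : Fin N, if (i : ℕ) < (j : ℕ) ∧ (j : ℕ) < m then
        (x.1 i * x.2 j - x.1 j * x.2 i) ^ 2
          + b i * (x.1 j) ^ 2 / (x.1 i) ^ 2 + b j * (x.1 i) ^ 2 / (x.1 j) ^ 2
      else 0)
    + ∑ i : Fin N, if (i : ℕ) < m then b i else 0

/-- The "right" integrals `C_{(m)}` (indices `N−m+1 ≤ i < j ≤ N` of the paper are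
the 0-indexed `N−m ≤ i < j` here). -/
noncomputable def Cright (N : ℕ) (b : Fin N → ℝ) (m : ℕ) : Phase N → ℝ :=
  fun x =>
    (∑ i : Fin N, ∑ j : Fin N, if N - m ≤ (i : ℕ) ∧ (i : ℕ) < (j : ℕ) then
        (x.1 i * x.2 j - x.1 j * x.2 i) ^ 2
          + b i * (x.1 j) ^ 2 / (x.1 i) ^ 2 + b j * (x.1 i) ^ 2 / (x.1 j) ^ 2
      else 0)
    + ∑ i : Fin N, if N - m ≤ (i : ℕ) then b i else 0

/-- The summand of `Cleft` and `Cright` attached to the pair `(i, j)`. -/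
def pairTerm {N : ℕ} (b : Fin N → ℝ) (i j : Fin N) : Phase N → ℝ := fun x =>
  (x.1 i * x.2 j - x.1 j * x.2 i) ^ 2
    + b i * (x.1 j) ^ 2 / (x.1 i) ^ 2 + b j * (x.1 i) ^ 2 / (x.1 j) ^ 2

/-- The Hamiltonian vector field of `g`. -/
def hamiltonianField {N : ℕ} (g : Phase N → ℝ) (x : Phase N) : Phase N :=
  (fun i => fderiv ℝ g x (0, Pi.single i 1), fun i => -fderiv ℝ g x (Pi.single i 1, 0))

lemma phase_eq_sum {N : ℕ} (v : Phase N) :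
    v = ∑ i : Fin N, (v.1 i • ((Pi.single i 1, 0) : Phase N)
      + v.2 i • ((0, Pi.single i 1) : Phase N)) := by
  ext k <;> simp [Prod.fst_sum, Prod.snd_sum, Finset.sum_apply, Pi.single_apply]

lemma pb_eq_fderiv_hamiltonianField {N : ℕ} (f g : Phase N → ℝ) (x : Phase N) :
    pb f g x = fderiv ℝ f x (hamiltonianField g x) := by
  rw [phase_eq_sum (hamiltonianField g x), map_sum]
  refine Finset.sum_congr rfl fun i _ => ?_
  simp only [map_add, map_smul, hamiltonianField, smul_eq_mul]
  ring

lemma hasDerivAt_position_line {N : ℕ} (x v : Phase N) (i : Fin N) :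
    HasDerivAt (fun t : ℝ => (x + t • v).1 i) (v.1 i) 0 := by
  simpa using ((hasDerivAt_id (0 : ℝ)).mul_const (v.1 i)).const_add (x.1 i)

lemma hasDerivAt_momentum_line {N : ℕ} (x v : Phase N) (i : Fin N) :
    HasDerivAt (fun t : ℝ => (x + t • v).2 i) (v.2 i) 0 := by
  simpa using ((hasDerivAt_id (0 : ℝ)).mul_const (v.2 i)).const_add (x.2 i)

lemma fderiv_apply_of_hasDerivAt_line {N : ℕ} {f : Phase N → ℝ} {x v : Phase N} {d : ℝ}
    (hf : DifferentiableAt ℝ f x) (h : HasDerivAt (fun t : ℝ => f (x + t • v)) d 0) :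
    fderiv ℝ f x v = d := by
  rw [← hf.lineDeriv_eq_fderiv]
  exact HasLineDerivAt.lineDeriv h

lemma differentiableAt_pairTerm {N : ℕ} (b : Fin N → ℝ) (i j : Fin N) (x : Phase N)
    (hi : x.1 i ≠ 0) (hj : x.1 j ≠ 0) : DifferentiableAt ℝ (pairTerm b i j) x := by
  unfold pairTerm
  fun_prop (disch := exact pow_ne_zero 2 (by assumption))

lemma fderiv_pairTerm_apply {N : ℕ} (b : Fin N → ℝ) (i j : Fin N) (x v : Phase N)
    (hi : x.1 i ≠ 0) (hj : x.1 j ≠ 0) :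
    fderiv ℝ (pairTerm b i j) x v =
      2 * (x.1 i * x.2 j - x.1 j * x.2 i)
          * (v.1 i * x.2 j + x.1 i * v.2 j - v.1 j * x.2 i - x.1 j * v.2 i)
        + 2 * b i * x.1 j * (v.1 j * x.1 i - x.1 j * v.1 i) / (x.1 i) ^ 3
        + 2 * b j * x.1 i * (v.1 i * x.1 j - x.1 i * v.1 j) / (x.1 j) ^ 3 := by
  refine fderiv_apply_of_hasDerivAt_line (differentiableAt_pairTerm b i j x hi hj) ?_
  have hqi := hasDerivAt_position_line x v i
  have hqj := hasDerivAt_position_line x v j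
  have hpi := hasDerivAt_momentum_line x v i
  have hpj := hasDerivAt_momentum_line x v j
  have h := ((((hqi.fun_mul hpj).fun_sub (hqj.fun_mul hpi)).fun_pow 2).fun_add
    (((hqj.fun_pow 2).const_mul (b i)).fun_div (hqi.fun_pow 2) (by simpa using hi))).fun_add
    (((hqi.fun_pow 2).const_mul (b j)).fun_div (hqj.fun_pow 2) (by simpa using hj))
  refine h.congr_deriv ?_
  simp only [zero_smul, add_zero]
  field_simp
  push_cast
  ring

lemma hamiltonianField_Jm {N : ℕ} (x : Phase N) :
    hamiltonianField (Jm N) x = (0, fun i => -(2 * x.1 i)) := by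
  have key (v : Phase N) : fderiv ℝ (Jm N) x v = ∑ i, 2 * x.1 i * v.1 i := by
    refine fderiv_apply_of_hasDerivAt_line
      (by unfold Jm; fun_prop) ?_
    refine (HasDerivAt.fun_sum fun i _ => (hasDerivAt_position_line x v i).fun_pow 2).congr_deriv ?_
    simp
  ext i <;> simp [hamiltonianField, key, Pi.single_apply]

lemma hamiltonianField_Jp {N : ℕ} (b : Fin N → ℝ) (x : Phase N) (hx : ∀ i, x.1 i ≠ 0) :
    hamiltonianField (Jp N b) x = (fun i => 2 * x.2 i, fun i => 2 * b i / (x.1 i) ^ 3) := by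
  have key (v : Phase N) : fderiv ℝ (Jp N b) x v
      = ∑ i, (2 * x.2 i * v.2 i - 2 * b i / (x.1 i) ^ 3 * v.1 i) := by
    refine fderiv_apply_of_hasDerivAt_line (DifferentiableAt.fun_sum fun i _ => by
      fun_prop (disch := exact pow_ne_zero 2 (hx i))) ?_
    refine (HasDerivAt.fun_sum fun i _ =>
      ((hasDerivAt_momentum_line x v i).fun_pow 2).fun_add
        ((hasDerivAt_const (0 : ℝ) (b i)).fun_div ((hasDerivAt_position_line x v i).fun_pow 2)
          (by simpa using hx i))).congr_deriv ?_
    refine Finset.sum_congr rfl fun i _ => ?_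
    have := hx i
    simp only [zero_smul, add_zero]
    field_simp
    push_cast
    ring
  ext i <;> simp [hamiltonianField, key, Pi.single_apply]

lemma hamiltonianField_J3 {N : ℕ} (x : Phase N) :
    hamiltonianField (J3 N) x = (x.1, fun i => -x.2 i) := by
  have key (v : Phase N) : fderiv ℝ (J3 N) x v = ∑ i, (v.1 i * x.2 i + x.1 i * v.2 i) := by
    refine fderiv_apply_of_hasDerivAt_line (by unfold J3; fun_prop) ?_
    refine (HasDerivAt.fun_sum fun i _ =>
      (hasDerivAt_position_line x v i).fun_mul (hasDerivAt_momentum_line x v i)).congr_deriv ?_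
    simp
  ext i <;> simp [hamiltonianField, key, Pi.single_apply]

lemma pb_pairTerm_Jm {N : ℕ} (b : Fin N → ℝ) (i j : Fin N) (x : Phase N)
    (hx : ∀ i, x.1 i ≠ 0) : pb (pairTerm b i j) (Jm N) x = 0 := by
  rw [pb_eq_fderiv_hamiltonianField, fderiv_pairTerm_apply b i j x _ (hx i) (hx j),
    hamiltonianField_Jm]
  simp only [Pi.zero_apply]
  ring

lemma pb_pairTerm_Jp {N : ℕ} (b : Fin N → ℝ) (i j : Fin N) (x : Phase N)
    (hx : ∀ i, x.1 i ≠ 0) : pb (pairTerm b i j) (Jp N b) x = 0 := by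
  rw [pb_eq_fderiv_hamiltonianField, fderiv_pairTerm_apply b i j x _ (hx i) (hx j),
    hamiltonianField_Jp b x hx]
  have := hx i
  have := hx j
  field_simp
  ring

lemma pb_pairTerm_J3 {N : ℕ} (b : Fin N → ℝ) (i j : Fin N) (x : Phase N)
    (hx : ∀ i, x.1 i ≠ 0) : pb (pairTerm b i j) (J3 N) x = 0 := by
  rw [pb_eq_fderiv_hamiltonianField, fderiv_pairTerm_apply b i j x _ (hx i) (hx j),
    hamiltonianField_J3]
  ring

/-- A function Poisson-commuting with all pair terms commutes with any sum of them. -/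
lemma pb_sum_pairTerm_eq_zero {N : ℕ} (b : Fin N → ℝ) (P : Fin N → Fin N → Prop)
    [∀ i j, Decidable (P i j)] (c : ℝ) (g : Phase N → ℝ) (x : Phase N) (hx : ∀ i, x.1 i ≠ 0)
    (hg : ∀ i j, pb (pairTerm b i j) g x = 0) :
    pb (fun y => (∑ i, ∑ j, if P i j then pairTerm b i j y else 0) + c) g x = 0 := by
  simp only [pb_eq_fderiv_hamiltonianField] at hg ⊢
  have hterm (i j : Fin N) : HasFDerivAt (fun y => if P i j then pairTerm b i j y else 0)
      (if P i j then fderiv ℝ (pairTerm b i j) x else 0) x := by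
    split_ifs
    · exact (differentiableAt_pairTerm b i j x (hx i) (hx j)).hasFDerivAt
    · exact hasFDerivAt_const 0 x
  have hsum := (HasFDerivAt.fun_sum (u := Finset.univ) fun i _ =>
    HasFDerivAt.fun_sum (u := Finset.univ) fun j _ => hterm i j).add_const c
  rw [hsum.fderiv]
  simp only [_root_.sum_apply]
  refine Finset.sum_eq_zero fun i _ => Finset.sum_eq_zero fun j _ => ?_
  split_ifs <;> simp [hg]

/-- for every `2 ≤ m ≤ N`, the integrals `C^{(m)}` and `C_{(m)}`
Poisson-commute with each of the generators `J_-`, `J_+`, `J_3` on the open set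
where every `q_i ≠ 0`. -/
theorem integrals_commute_with_generators (N : ℕ) (hN : 2 ≤ N) (b : Fin N → ℝ)
    (m : ℕ) (hm : 2 ≤ m) (hmN : m ≤ N)
    (x : Phase N) (hx : ∀ i, x.1 i ≠ 0) :
    pb (Cleft N b m) (Jm N) x = 0 ∧
    pb (Cleft N b m) (Jp N b) x = 0 ∧
    pb (Cleft N b m) (J3 N) x = 0 ∧
    pb (Cright N b m) (Jm N) x = 0 ∧
    pb (Cright N b m) (Jp N b) x = 0 ∧
    pb (Cright N b m) (J3 N) x = 0 := by
  have left (g : Phase N → ℝ) (hg : ∀ i j, pb (pairTerm b i j) g x = 0) :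
      pb (Cleft N b m) g x = 0 :=
    pb_sum_pairTerm_eq_zero b (fun i j => (i : ℕ) < (j : ℕ) ∧ (j : ℕ) < m) _ g x hx hg
  have right (g : Phase N → ℝ) (hg : ∀ i j, pb (pairTerm b i j) g x = 0) :
      pb (Cright N b m) g x = 0 :=
    pb_sum_pairTerm_eq_zero b (fun i j => N - m ≤ (i : ℕ) ∧ (i : ℕ) < (j : ℕ)) _ g x hx hg
  have hm' := fun i j => pb_pairTerm_Jm b i j x hx
  have hp := fun i j => pb_pairTerm_Jp b i j x hx
  have h3 := fun i j => pb_pairTerm_J3 b i j x hx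
  exact ⟨left _ hm', left _ hp, left _ h3, right _ hm', right _ hp, right _ h3⟩
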